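/- In PCMLL, product eliminations and entropy rules permute below implicative eliminations: suppose a derivation ends with an implicative elimination rule R' (\_e, /_e or ⊸_e), one of whose premises Γ[Δ] ⊢ C is the conclusion of a product elimination rule R (⊗_e with left premise Δ ⊢ A⊗B and right premise Γ[(A,B)] ⊢ C, or ⊙_e with left premise Δ ⊢ A⊙B and right premise Γ[⟨A;B⟩] ⊢ C), the other premise of R' being Θ ⊢ U with derivation δ2. Then there is a derivation of the same end-sequent whose last rule is R, obtained by first applying R' to δ2 and the derivation of the right premise of R, and then applying R. The same holds when R is an entropy rule. -/

import Mathlib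

/-!  Partially commutative multiplicative intuitionistic linear logic (PCMLL):
     formulas, series-parallel contexts, entropy, natural deduction
     derivations, principal branches, extended redexes, normal derivations. -/

/-- Formulas of PCMLL. -/
inductive Fm : Type
  | var   : ℕ → Fm
  | nprod : Fm → Fm → Fm   -- A ⊙ B (non-commutative product)
  | cprod : Fm → Fm → Fm   -- A ⊗ B (commutative product)
  | ldiv  : Fm → Fm → Fm   -- ldiv A C = A \ C
  | rdiv  : Fm → Fm → Fm   -- rdiv C A = C / A
  | limp  : Fm → Fm → Fm   -- limp A C = A ⊸ C
  deriving DecidableEq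

/-- Series-parallel contexts: single formulas, series composition `⟨Γ;Δ⟩`
and parallel composition `(Γ,Δ)`. -/
inductive Ctx : Type
  | leaf : Fm → Ctx
  | seq  : Ctx → Ctx → Ctx
  | par  : Ctx → Ctx → Ctx
  deriving DecidableEq

/-- The list of formula occurrences of a context, from left to right. -/
def leaves : Ctx → List Fm
  | .leaf A => [A]
  | .seq a b => leaves a ++ leaves b
  | .par a b => leaves a ++ leaves b

def nsize (Γ : Ctx) : ℕ := (leaves Γ).length

/-- The series-parallel strict order on the occurrences (numbered from left to
right) of a context: `i < j` iff their lowest common node is a series node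
with `i` on the left and `j` on the right. -/
def ctxLt : Ctx → ℕ → ℕ → Prop
  | .leaf _, _, _ => False
  | .seq a b, i, j =>
      (i < nsize a ∧ nsize a ≤ j ∧ j < nsize a + nsize b) ∨
      ctxLt a i j ∨
      (nsize a ≤ i ∧ nsize a ≤ j ∧ ctxLt b (i - nsize a) (j - nsize a))
  | .par a b, i, j =>
      ctxLt a i j ∨
      (nsize a ≤ i ∧ nsize a ≤ j ∧ ctxLt b (i - nsize a) (j - nsize a))

/-- Entropy `Γ' ⊑ Γ` : same underlying multiset of formulas and the order of
`Γ'` is included in the order of `Γ`. -/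
def SubOrder (Γ' Γ : Ctx) : Prop :=
  ∃ e : Fin (leaves Γ').length ≃ Fin (leaves Γ).length,
    (∀ i, (leaves Γ').get i = (leaves Γ).get (e i)) ∧
    (∀ i j : Fin (leaves Γ').length, ctxLt Γ' i j → ctxLt Γ (e i) (e j))

/-- One-hole contexts. -/
inductive CCtx : Type
  | hole : CCtx
  | seqL : CCtx → Ctx → CCtx
  | seqR : Ctx → CCtx → CCtx
  | parL : CCtx → Ctx → CCtx
  | parR : Ctx → CCtx → CCtx
  deriving DecidableEq

/-- Filling the hole of a one-hole context. -/
def fill : CCtx → Ctx → Ctx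
  | .hole, Δ => Δ
  | .seqL K b, Δ => .seq (fill K Δ) b
  | .seqR a K, Δ => .seq a (fill K Δ)
  | .parL K b, Δ => .par (fill K Δ) b
  | .parR a K, Δ => .par a (fill K Δ)

/-- Composition of one-hole contexts: `fill (ccomp K K') Δ = fill K (fill K' Δ)`. -/
def ccomp : CCtx → CCtx → CCtx
  | .hole, K => K
  | .seqL K₀ b, K => .seqL (ccomp K₀ K) b
  | .seqR a K₀, K => .seqR a (ccomp K₀ K)
  | .parL K₀ b, K => .parL (ccomp K₀ K) b
  | .parR a K₀, K => .parR a (ccomp K₀ K)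

/-- Natural deduction derivations of PCMLL. -/
inductive PDeriv : Ctx → Fm → Type
  | ax (A : Fm) : PDeriv (.leaf A) A
  | ldivE {Γ Δ : Ctx} {A C : Fm} :
      PDeriv Γ A → PDeriv Δ (Fm.ldiv A C) → PDeriv (.seq Γ Δ) C
  | rdivE {Δ Γ : Ctx} {A C : Fm} :
      PDeriv Δ (Fm.rdiv C A) → PDeriv Γ A → PDeriv (.seq Δ Γ) C
  | limpE {Γ Δ : Ctx} {A C : Fm} :
      PDeriv Γ A → PDeriv Δ (Fm.limp A C) → PDeriv (.par Γ Δ) C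
  | ldivI {Γ : Ctx} {A C : Fm} :
      PDeriv (.seq (.leaf A) Γ) C → PDeriv Γ (Fm.ldiv A C)
  | rdivI {Γ : Ctx} {A C : Fm} :
      PDeriv (.seq Γ (.leaf A)) C → PDeriv Γ (Fm.rdiv C A)
  | limpI {Γ : Ctx} {A C : Fm} :
      PDeriv (.par (.leaf A) Γ) C → PDeriv Γ (Fm.limp A C)
  | nprodI {Δ Γ : Ctx} {A B : Fm} :
      PDeriv Δ A → PDeriv Γ B → PDeriv (.seq Δ Γ) (Fm.nprod A B)
  | cprodI {Δ Γ : Ctx} {A B : Fm} :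
      PDeriv Δ A → PDeriv Γ B → PDeriv (.par Δ Γ) (Fm.cprod A B)
  | nprodE {Δ : Ctx} {A B : Fm} {K : CCtx} {C : Fm} :
      PDeriv Δ (Fm.nprod A B) →
      PDeriv (fill K (.seq (.leaf A) (.leaf B))) C → PDeriv (fill K Δ) C
  | cprodE {Δ : Ctx} {A B : Fm} {K : CCtx} {C : Fm} :
      PDeriv Δ (Fm.cprod A B) →
      PDeriv (fill K (.par (.leaf A) (.leaf B))) C → PDeriv (fill K Δ) C
  | entropy {Γ Γ' : Ctx} {C : Fm} :
      PDeriv Γ C → SubOrder Γ' Γ → PDeriv Γ' C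

/-- Names of the rules of PCMLL. -/
inductive Rule : Type
  | ax | ldivE | rdivE | limpE | ldivI | rdivI | limpI
  | nprodI | cprodI | nprodE | cprodE | entropy
  deriving DecidableEq

/-- A derivation together with its sequent. -/
abbrev PTree : Type := Σ (Γ : Ctx) (C : Fm), PDeriv Γ C

/-- The last rule of a derivation. -/
def lastRule : ∀ {Γ C}, PDeriv Γ C → Rule
  | _, _, .ax _ => .ax
  | _, _, .ldivE _ _ => .ldivE
  | _, _, .rdivE _ _ => .rdivE
  | _, _, .limpE _ _ => .limpE
  | _, _, .ldivI _ => .ldivI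
  | _, _, .rdivI _ => .rdivI
  | _, _, .limpI _ => .limpI
  | _, _, .nprodI _ _ => .nprodI
  | _, _, .cprodI _ _ => .cprodI
  | _, _, .nprodE _ _ => .nprodE
  | _, _, .cprodE _ _ => .cprodE
  | _, _, .entropy _ _ => .entropy

/-- The premises of the last rule of a derivation. -/
def premises : ∀ {Γ C}, PDeriv Γ C → List PTree
  | _, _, .ax _ => []
  | _, _, .ldivE d₁ d₂ => [⟨_, _, d₁⟩, ⟨_, _, d₂⟩]
  | _, _, .rdivE d₁ d₂ => [⟨_, _, d₁⟩, ⟨_, _, d₂⟩]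
  | _, _, .limpE d₁ d₂ => [⟨_, _, d₁⟩, ⟨_, _, d₂⟩]
  | _, _, .ldivI d => [⟨_, _, d⟩]
  | _, _, .rdivI d => [⟨_, _, d⟩]
  | _, _, .limpI d => [⟨_, _, d⟩]
  | _, _, .nprodI d₁ d₂ => [⟨_, _, d₁⟩, ⟨_, _, d₂⟩]
  | _, _, .cprodI d₁ d₂ => [⟨_, _, d₁⟩, ⟨_, _, d₂⟩]
  | _, _, .nprodE d₁ d₂ => [⟨_, _, d₁⟩, ⟨_, _, d₂⟩]
  | _, _, .cprodE d₁ d₂ => [⟨_, _, d₁⟩, ⟨_, _, d₂⟩]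
  | _, _, .entropy d _ => [⟨_, _, d⟩]

/-- The premise through which the principal branch continues: the premise of a
unary rule (introduction or entropy), the major premise of an implicative
elimination, the premise in which the hypotheses are discharged for a product
elimination. -/
def principalPremise : ∀ {Γ C}, PDeriv Γ C → Option PTree
  | _, _, .ax _ => none
  | _, _, .ldivE _ d₂ => some ⟨_, _, d₂⟩
  | _, _, .rdivE d₁ _ => some ⟨_, _, d₁⟩
  | _, _, .limpE _ d₂ => some ⟨_, _, d₂⟩
  | _, _, .ldivI d => some ⟨_, _, d⟩
  | _, _, .rdivI d => some ⟨_, _, d⟩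
  | _, _, .limpI d => some ⟨_, _, d⟩
  | _, _, .nprodI _ _ => none
  | _, _, .cprodI _ _ => none
  | _, _, .nprodE _ d₂ => some ⟨_, _, d₂⟩
  | _, _, .cprodE _ d₂ => some ⟨_, _, d₂⟩
  | _, _, .entropy d _ => some ⟨_, _, d⟩

/-- Number of rules in a derivation. -/
def psize : ∀ {Γ C}, PDeriv Γ C → ℕ
  | _, _, .ax _ => 1
  | _, _, .ldivE d₁ d₂ => psize d₁ + psize d₂ + 1
  | _, _, .rdivE d₁ d₂ => psize d₁ + psize d₂ + 1
  | _, _, .limpE d₁ d₂ => psize d₁ + psize d₂ + 1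
  | _, _, .ldivI d => psize d + 1
  | _, _, .rdivI d => psize d + 1
  | _, _, .limpI d => psize d + 1
  | _, _, .nprodI d₁ d₂ => psize d₁ + psize d₂ + 1
  | _, _, .cprodI d₁ d₂ => psize d₁ + psize d₂ + 1
  | _, _, .nprodE d₁ d₂ => psize d₁ + psize d₂ + 1
  | _, _, .cprodE d₁ d₂ => psize d₁ + psize d₂ + 1
  | _, _, .entropy d _ => psize d + 1

/-- All subderivations (occurrences of sequents) of a derivation. -/
def subtrees : ∀ {Γ C}, PDeriv Γ C → List PTree
  | _, _, .ax A => [⟨_, _, .ax A⟩]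
  | _, _, .ldivE d₁ d₂ => ⟨_, _, .ldivE d₁ d₂⟩ :: (subtrees d₁ ++ subtrees d₂)
  | _, _, .rdivE d₁ d₂ => ⟨_, _, .rdivE d₁ d₂⟩ :: (subtrees d₁ ++ subtrees d₂)
  | _, _, .limpE d₁ d₂ => ⟨_, _, .limpE d₁ d₂⟩ :: (subtrees d₁ ++ subtrees d₂)
  | _, _, .ldivI d => ⟨_, _, .ldivI d⟩ :: subtrees d
  | _, _, .rdivI d => ⟨_, _, .rdivI d⟩ :: subtrees d
  | _, _, .limpI d => ⟨_, _, .limpI d⟩ :: subtrees d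
  | _, _, .nprodI d₁ d₂ => ⟨_, _, .nprodI d₁ d₂⟩ :: (subtrees d₁ ++ subtrees d₂)
  | _, _, .cprodI d₁ d₂ => ⟨_, _, .cprodI d₁ d₂⟩ :: (subtrees d₁ ++ subtrees d₂)
  | _, _, .nprodE d₁ d₂ => ⟨_, _, .nprodE d₁ d₂⟩ :: (subtrees d₁ ++ subtrees d₂)
  | _, _, .cprodE d₁ d₂ => ⟨_, _, .cprodE d₁ d₂⟩ :: (subtrees d₁ ++ subtrees d₂)
  | _, _, .entropy d h => ⟨_, _, .entropy d h⟩ :: subtrees d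

/-- `stepN k d` goes `k` steps up the principal branch starting at `d`. -/
def stepN : ℕ → PTree → Option PTree
  | 0, d => some d
  | k + 1, d => (principalPremise d.2.2).bind (stepN k)

def ImpElim (r : Rule) : Prop := r = .ldivE ∨ r = .rdivE ∨ r = .limpE

def ProdElim (r : Rule) : Prop := r = .nprodE ∨ r = .cprodE

def IsElim (r : Rule) : Prop := ImpElim r ∨ ProdElim r

def IsIntro (r : Rule) : Prop :=
  r = .ldivI ∨ r = .rdivI ∨ r = .limpI ∨ r = .nprodI ∨ r = .cprodI

/-- There is a path of length `k` along the principal branch from `d₀` to the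
conclusion of an introduction rule with the same right-hand-side formula. -/
def ExtRedexFrom (k : ℕ) (d₀ : PTree) : Prop :=
  ∃ dk : PTree, stepN k d₀ = some dk ∧ IsIntro (lastRule dk.2.2) ∧ dk.2.1 = d₀.2.1

/-- The root of `d` is an elimination rule whose principal premise starts a
`k`-extended-redex. -/
def ExtRedexAt (k : ℕ) (d : PTree) : Prop :=
  IsElim (lastRule d.2.2) ∧
    ∃ d₀ : PTree, principalPremise d.2.2 = some d₀ ∧ ExtRedexFrom k d₀

/-- The derivation contains a `k`-extended-redex. -/
def HasExtRedex {Γ C} (k : ℕ) (δ : PDeriv Γ C) : Prop :=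
  ∃ d ∈ subtrees δ, ExtRedexAt k d

/-- A PCMLL derivation is normal if it contains no `k`-extended-redex for any `k`. -/
def NormalDeriv {Γ C} (δ : PDeriv Γ C) : Prop :=
  ∀ k, ¬ HasExtRedex k δ

/-- Subformula relation. -/
inductive Subf : Fm → Fm → Prop
  | refl (A : Fm) : Subf A A
  | nprodL {F A B} : Subf F A → Subf F (Fm.nprod A B)
  | nprodR {F A B} : Subf F B → Subf F (Fm.nprod A B)
  | cprodL {F A B} : Subf F A → Subf F (Fm.cprod A B)
  | cprodR {F A B} : Subf F B → Subf F (Fm.cprod A B)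
  | ldivL {F A B} : Subf F A → Subf F (Fm.ldiv A B)
  | ldivR {F A B} : Subf F B → Subf F (Fm.ldiv A B)
  | rdivL {F A B} : Subf F A → Subf F (Fm.rdiv A B)
  | rdivR {F A B} : Subf F B → Subf F (Fm.rdiv A B)
  | limpL {F A B} : Subf F A → Subf F (Fm.limp A B)
  | limpR {F A B} : Subf F B → Subf F (Fm.limp A B)

theorem ctxLt_bound : ∀ (a : Ctx) (i j : ℕ), ctxLt a i j → i < nsize a ∧ j < nsize a
  | .leaf _, i, j, h => by simp [ctxLt] at h
  | .seq a b, i, j, h => by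
      have ha := ctxLt_bound a i j
      have hb := ctxLt_bound b (i - nsize a) (j - nsize a)
      have hn : nsize (.seq a b) = nsize a + nsize b := by simp [nsize, leaves]
      rw [hn]
      simp only [ctxLt] at h
      rcases h with h | h | ⟨h1, h2, h3⟩
      · omega
      · have := ha h; omega
      · have := hb h3; omega
  | .par a b, i, j, h => by
      have ha := ctxLt_bound a i j
      have hb := ctxLt_bound b (i - nsize a) (j - nsize a)
      have hn : nsize (.par a b) = nsize a + nsize b := by simp [nsize, leaves]
      rw [hn]
      simp only [ctxLt] at h
      rcases h with h | ⟨h1, h2, h3⟩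
      · have := ha h; omega
      · have := hb h3; omega

theorem subOrder_refl (a : Ctx) : SubOrder a a :=
  ⟨Equiv.refl _, fun _ => rfl, fun _ _ h => h⟩

/-- Side-by-side combination of two label-preserving bijections. -/
theorem append_equiv {l₁ l₂ m₁ m₂ : List Fm}
    (e₁ : Fin l₁.length ≃ Fin m₁.length) (e₂ : Fin l₂.length ≃ Fin m₂.length)
    (h₁ : ∀ i, l₁.get i = m₁.get (e₁ i)) (h₂ : ∀ i, l₂.get i = m₂.get (e₂ i)) :
    ∃ e : Fin (l₁ ++ l₂).length ≃ Fin (m₁ ++ m₂).length,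
      (∀ i, (l₁ ++ l₂).get i = (m₁ ++ m₂).get (e i)) ∧
      (∀ i (h : i.1 < l₁.length), (e i).1 = (e₁ ⟨i.1, h⟩).1) ∧
      (∀ i (_ : l₁.length ≤ i.1) (h : i.1 - l₁.length < l₂.length),
        (e i).1 = m₁.length + (e₂ ⟨i.1 - l₁.length, h⟩).1) := by
  let e : Fin (l₁ ++ l₂).length ≃ Fin (m₁ ++ m₂).length :=
    (finCongr List.length_append).trans (finSumFinEquiv.symm.trans
      ((Equiv.sumCongr e₁ e₂).trans (finSumFinEquiv.trans (finCongr List.length_append.symm))))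
  have hL : ∀ i (h : i.1 < l₁.length), (e i).1 = (e₁ ⟨i.1, h⟩).1 := by
    intro i h
    have : finCongr List.length_append i = Fin.castAdd l₂.length ⟨i.1, h⟩ := by
      ext; simp
    simp only [e, Equiv.trans_apply, this, finSumFinEquiv_symm_apply_castAdd]
    simp
  have hR : ∀ i (_ : l₁.length ≤ i.1) (h : i.1 - l₁.length < l₂.length),
        (e i).1 = m₁.length + (e₂ ⟨i.1 - l₁.length, h⟩).1 := by
    intro i h0 h
    have : finCongr List.length_append i = Fin.natAdd l₁.length ⟨i.1 - l₁.length, h⟩ := by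
      ext; simp; omega
    simp only [e, Equiv.trans_apply, this, finSumFinEquiv_symm_apply_natAdd]
    simp
  refine ⟨e, ?_, hL, hR⟩
  intro i
  have hi : i.1 < l₁.length + l₂.length := lt_of_lt_of_eq i.2 List.length_append
  by_cases h : i.1 < l₁.length
  · have h3 := hL i h
    have h4 := h₁ ⟨i.1, h⟩
    simp only [List.get_eq_getElem] at h4 ⊢
    rw [List.getElem_append_left h, h4]
    simp only [h3]
    rw [List.getElem_append_left]
  · have h' : i.1 - l₁.length < l₂.length := by omega
    have h3 := hR i (by omega) h'
    have h4 := h₂ ⟨i.1 - l₁.length, h'⟩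
    simp only [List.get_eq_getElem] at h4 ⊢
    rw [List.getElem_append_right (by omega), h4]
    simp only [h3]
    rw [List.getElem_append_right (by omega)]
    simp

theorem subOrder_seq {a' a b' b : Ctx} (h₁ : SubOrder a' a) (h₂ : SubOrder b' b) :
    SubOrder (.seq a' b') (.seq a b) := by
  obtain ⟨e₁, l₁, o₁⟩ := h₁
  obtain ⟨e₂, l₂, o₂⟩ := h₂
  obtain ⟨e, hl, eL, eR⟩ := append_equiv e₁ e₂ l₁ l₂
  refine ⟨e, hl, ?_⟩
  change ∀ i j : Fin (leaves a' ++ leaves b').length,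
    ctxLt (.seq a' b') i.1 j.1 → ctxLt (.seq a b) (e i).1 (e j).1
  intro i j h
  simp only [ctxLt] at h ⊢
  have bA := ctxLt_bound a' i.1 j.1
  have bB := ctxLt_bound b' (i.1 - nsize a') (j.1 - nsize a')
  simp only [nsize] at h bA bB ⊢
  rcases h with h | h | ⟨h1, h2, h3⟩
  · obtain ⟨h1, h2, h3⟩ := h
    have e1 := eL i h1
    have e2 := eR j h2 (by omega)
    refine Or.inl ?_
    have b1 := (e₁ ⟨i.1, h1⟩).2
    have b2 := (e₂ ⟨j.1 - (leaves a').length, by omega⟩).2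
    omega
  · obtain ⟨b1, b2⟩ := bA h
    refine Or.inr (Or.inl ?_)
    rw [eL i b1, eL j b2]
    exact o₁ ⟨i.1, b1⟩ ⟨j.1, b2⟩ h
  · obtain ⟨b1, b2⟩ := bB h3
    refine Or.inr (Or.inr ?_)
    rw [eR i h1 b1, eR j h2 b2]
    refine ⟨by omega, by omega, ?_⟩
    rw [Nat.add_sub_cancel_left, Nat.add_sub_cancel_left]
    exact o₂ ⟨_, b1⟩ ⟨_, b2⟩ h3

theorem subOrder_par {a' a b' b : Ctx} (h₁ : SubOrder a' a) (h₂ : SubOrder b' b) :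
    SubOrder (.par a' b') (.par a b) := by
  obtain ⟨e₁, l₁, o₁⟩ := h₁
  obtain ⟨e₂, l₂, o₂⟩ := h₂
  obtain ⟨e, hl, eL, eR⟩ := append_equiv e₁ e₂ l₁ l₂
  refine ⟨e, hl, ?_⟩
  change ∀ i j : Fin (leaves a' ++ leaves b').length,
    ctxLt (.par a' b') i.1 j.1 → ctxLt (.par a b) (e i).1 (e j).1
  intro i j h
  simp only [ctxLt] at h ⊢
  have bA := ctxLt_bound a' i.1 j.1
  have bB := ctxLt_bound b' (i.1 - nsize a') (j.1 - nsize a')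
  simp only [nsize] at h bA bB ⊢
  rcases h with h | ⟨h1, h2, h3⟩
  · obtain ⟨b1, b2⟩ := bA h
    refine Or.inl ?_
    rw [eL i b1, eL j b2]
    exact o₁ ⟨i.1, b1⟩ ⟨j.1, b2⟩ h
  · obtain ⟨b1, b2⟩ := bB h3
    refine Or.inr ?_
    rw [eR i h1 b1, eR j h2 b2]
    refine ⟨by omega, by omega, ?_⟩
    rw [Nat.add_sub_cancel_left, Nat.add_sub_cancel_left]
    exact o₂ ⟨_, b1⟩ ⟨_, b2⟩ h3

theorem perm_close {P Q R : Prop} (hP : P) (hQ : Q) (hR : R) : P ∧ Q ∧ R := ⟨hP, hQ, hR⟩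

/-- In PCMLL, product eliminations and entropy rules permute
below implicative eliminations: if a derivation ends with an implicative
elimination `R'` one of whose premises `p` is the conclusion of a product
elimination or entropy rule `R`, then there is a derivation of the same
end-sequent whose last rule is `R`, obtained by first applying `R'` to the
other premise of `R'` and to the principal premise of `R`, and then applying
`R`. -/
theorem product_entropy_permute_below_implicative_elim
    {Ξ : Ctx} {V : Fm} (δe : PDeriv Ξ V)
    (himp : ImpElim (lastRule δe))
    (p : PTree) (hp : p ∈ premises δe)
    (hr : ProdElim (lastRule p.2.2) ∨ lastRule p.2.2 = Rule.entropy) :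
    ∃ δ' : PDeriv Ξ V,
      lastRule δ' = lastRule p.2.2 ∧
      ∃ q ∈ premises δ',
        lastRule q.2.2 = lastRule δe ∧
        (∀ s : PTree, principalPremise p.2.2 = some s → s ∈ premises q.2.2) ∧
        (∀ t ∈ premises δe, t ≠ p → t ∈ premises q.2.2) ∧
        (∀ u ∈ premises p.2.2, principalPremise p.2.2 ≠ some u → u ∈ premises δ') := by
  cases δe with
  | ldivE d₁ d₂ =>
    simp only [premises, List.mem_cons, List.not_mem_nil, or_false] at hp
    rcases hp with rfl | rfl
    · cases d₁ with
      | @nprodE Δ A B K _ g₁ g₂ =>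
        refine ⟨@PDeriv.nprodE Δ A B (.seqL K _) _ g₁ (.ldivE g₂ d₂), rfl,
          ⟨_, _, .ldivE g₂ d₂⟩, List.mem_cons_of_mem _ List.mem_cons_self, rfl, ?_⟩
        refine perm_close ?_ ?_ ?_
          <;> simp [premises, principalPremise]
      | @cprodE Δ A B K _ g₁ g₂ =>
        refine ⟨@PDeriv.cprodE Δ A B (.seqL K _) _ g₁ (.ldivE g₂ d₂), rfl,
          ⟨_, _, .ldivE g₂ d₂⟩, List.mem_cons_of_mem _ List.mem_cons_self, rfl, ?_⟩
        refine perm_close ?_ ?_ ?_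
          <;> simp [premises, principalPremise]
      | entropy g h =>
        refine ⟨.entropy (.ldivE g d₂) (subOrder_seq h (subOrder_refl _)), rfl,
          ⟨_, _, .ldivE g d₂⟩, List.mem_cons_self, rfl, ?_⟩
        refine perm_close ?_ ?_ ?_
          <;> simp [premises, principalPremise]
      | _ => simp [lastRule, ProdElim] at hr
    · cases d₂ with
      | @nprodE Δ A B K _ g₁ g₂ =>
        refine ⟨@PDeriv.nprodE Δ A B (.seqR _ K) _ g₁ (.ldivE d₁ g₂), rfl,
          ⟨_, _, .ldivE d₁ g₂⟩, List.mem_cons_of_mem _ List.mem_cons_self, rfl, ?_⟩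
        refine perm_close ?_ ?_ ?_
          <;> simp [premises, principalPremise]
      | @cprodE Δ A B K _ g₁ g₂ =>
        refine ⟨@PDeriv.cprodE Δ A B (.seqR _ K) _ g₁ (.ldivE d₁ g₂), rfl,
          ⟨_, _, .ldivE d₁ g₂⟩, List.mem_cons_of_mem _ List.mem_cons_self, rfl, ?_⟩
        refine perm_close ?_ ?_ ?_
          <;> simp [premises, principalPremise]
      | entropy g h =>
        refine ⟨.entropy (.ldivE d₁ g) (subOrder_seq (subOrder_refl _) h), rfl,
          ⟨_, _, .ldivE d₁ g⟩, List.mem_cons_self, rfl, ?_⟩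
        refine perm_close ?_ ?_ ?_
          <;> simp [premises, principalPremise]
      | _ => simp [lastRule, ProdElim] at hr
  | rdivE d₁ d₂ =>
    simp only [premises, List.mem_cons, List.not_mem_nil, or_false] at hp
    rcases hp with rfl | rfl
    · cases d₁ with
      | @nprodE Δ A B K _ g₁ g₂ =>
        refine ⟨@PDeriv.nprodE Δ A B (.seqL K _) _ g₁ (.rdivE g₂ d₂), rfl,
          ⟨_, _, .rdivE g₂ d₂⟩, List.mem_cons_of_mem _ List.mem_cons_self, rfl, ?_⟩
        refine perm_close ?_ ?_ ?_
          <;> simp [premises, principalPremise]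
      | @cprodE Δ A B K _ g₁ g₂ =>
        refine ⟨@PDeriv.cprodE Δ A B (.seqL K _) _ g₁ (.rdivE g₂ d₂), rfl,
          ⟨_, _, .rdivE g₂ d₂⟩, List.mem_cons_of_mem _ List.mem_cons_self, rfl, ?_⟩
        refine perm_close ?_ ?_ ?_
          <;> simp [premises, principalPremise]
      | entropy g h =>
        refine ⟨.entropy (.rdivE g d₂) (subOrder_seq h (subOrder_refl _)), rfl,
          ⟨_, _, .rdivE g d₂⟩, List.mem_cons_self, rfl, ?_⟩
        refine perm_close ?_ ?_ ?_
          <;> simp [premises, principalPremise]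
      | _ => simp [lastRule, ProdElim] at hr
    · cases d₂ with
      | @nprodE Δ A B K _ g₁ g₂ =>
        refine ⟨@PDeriv.nprodE Δ A B (.seqR _ K) _ g₁ (.rdivE d₁ g₂), rfl,
          ⟨_, _, .rdivE d₁ g₂⟩, List.mem_cons_of_mem _ List.mem_cons_self, rfl, ?_⟩
        refine perm_close ?_ ?_ ?_
          <;> simp [premises, principalPremise]
      | @cprodE Δ A B K _ g₁ g₂ =>
        refine ⟨@PDeriv.cprodE Δ A B (.seqR _ K) _ g₁ (.rdivE d₁ g₂), rfl,
          ⟨_, _, .rdivE d₁ g₂⟩, List.mem_cons_of_mem _ List.mem_cons_self, rfl, ?_⟩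
        refine perm_close ?_ ?_ ?_
          <;> simp [premises, principalPremise]
      | entropy g h =>
        refine ⟨.entropy (.rdivE d₁ g) (subOrder_seq (subOrder_refl _) h), rfl,
          ⟨_, _, .rdivE d₁ g⟩, List.mem_cons_self, rfl, ?_⟩
        refine perm_close ?_ ?_ ?_
          <;> simp [premises, principalPremise]
      | _ => simp [lastRule, ProdElim] at hr
  | limpE d₁ d₂ =>
    simp only [premises, List.mem_cons, List.not_mem_nil, or_false] at hp
    rcases hp with rfl | rfl
    · cases d₁ with
      | @nprodE Δ A B K _ g₁ g₂ =>
        refine ⟨@PDeriv.nprodE Δ A B (.parL K _) _ g₁ (.limpE g₂ d₂), rfl,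
          ⟨_, _, .limpE g₂ d₂⟩, List.mem_cons_of_mem _ List.mem_cons_self, rfl, ?_⟩
        refine perm_close ?_ ?_ ?_
          <;> simp [premises, principalPremise]
      | @cprodE Δ A B K _ g₁ g₂ =>
        refine ⟨@PDeriv.cprodE Δ A B (.parL K _) _ g₁ (.limpE g₂ d₂), rfl,
          ⟨_, _, .limpE g₂ d₂⟩, List.mem_cons_of_mem _ List.mem_cons_self, rfl, ?_⟩
        refine perm_close ?_ ?_ ?_
          <;> simp [premises, principalPremise]
      | entropy g h =>
        refine ⟨.entropy (.limpE g d₂) (subOrder_par h (subOrder_refl _)), rfl,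
          ⟨_, _, .limpE g d₂⟩, List.mem_cons_self, rfl, ?_⟩
        refine perm_close ?_ ?_ ?_
          <;> simp [premises, principalPremise]
      | _ => simp [lastRule, ProdElim] at hr
    · cases d₂ with
      | @nprodE Δ A B K _ g₁ g₂ =>
        refine ⟨@PDeriv.nprodE Δ A B (.parR _ K) _ g₁ (.limpE d₁ g₂), rfl,
          ⟨_, _, .limpE d₁ g₂⟩, List.mem_cons_of_mem _ List.mem_cons_self, rfl, ?_⟩
        refine perm_close ?_ ?_ ?_
          <;> simp [premises, principalPremise]
      | @cprodE Δ A B K _ g₁ g₂ =>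
        refine ⟨@PDeriv.cprodE Δ A B (.parR _ K) _ g₁ (.limpE d₁ g₂), rfl,
          ⟨_, _, .limpE d₁ g₂⟩, List.mem_cons_of_mem _ List.mem_cons_self, rfl, ?_⟩
        refine perm_close ?_ ?_ ?_
          <;> simp [premises, principalPremise]
      | entropy g h =>
        refine ⟨.entropy (.limpE d₁ g) (subOrder_par (subOrder_refl _) h), rfl,
          ⟨_, _, .limpE d₁ g⟩, List.mem_cons_self, rfl, ?_⟩
        refine perm_close ?_ ?_ ?_
          <;> simp [premises, principalPremise]
      | _ => simp [lastRule, ProdElim] at hr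
  | _ => simp [lastRule, ImpElim] at himp
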